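/- Let n > 4 and s ∈ (0,1), let 𝓗 be the mixed heat kernel, 𝓩(x) = ∫₀^{+∞} 𝓗(x,t) dt, and define v(x) := ∫_{B_{1/2}} 𝓩(x−y) dy. Then v > 0 in ℝⁿ, lim_{|x|→+∞} v(x) = 0, and there is a constant c₂ > 0 such that 0 < v(x) ≤ c₂/|x|^{n−2s} for every |x| > 1. -/

import Mathlib

open MeasureTheory Metric Set
open scoped RealInnerProductSpace
noncomputable section

/-- The mixed heat kernel `𝓗(x,t) = ∫_{ℝⁿ} e^{-t(|ξ|² + |ξ|^{2s}) + 2πi x·ξ} dξ`. -/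
def mixedHeatKernel (n : ℕ) (s : ℝ) (x : EuclideanSpace ℝ (Fin n)) (t : ℝ) : ℝ :=
  (∫ ξ : EuclideanSpace ℝ (Fin n),
    Complex.exp (-(t : ℂ) * ((‖ξ‖ ^ 2 + ‖ξ‖ ^ (2 * s) : ℝ) : ℂ)
      + 2 * (Real.pi : ℂ) * Complex.I * ((⟪x, ξ⟫ : ℝ) : ℂ))).re

/-- The fundamental solution `𝓩(x) = ∫₀^{+∞} 𝓗(x,t) dt`. -/
def mixedZ (n : ℕ) (s : ℝ) (x : EuclideanSpace ℝ (Fin n)) : ℝ :=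
  ∫ t in Ioi (0 : ℝ), mixedHeatKernel n s x t


namespace MixedAux
open Filter Topology

lemma lim_one {Ω : Type*} [MeasurableSpace Ω] (μ : Measure Ω) (h w : Ω → ℝ)
    (hm : Measurable h) (h0 : ∀ ω, 0 ≤ h ω) (F : ℕ → ℝ → ℝ) (f : ℝ → ℝ)
    (hF : ∀ k, Measurable (F k)) (M : ℝ) (hb : ∀ k, ∀ l, 0 ≤ l → |F k l| ≤ M)
    (hl : ∀ l, 0 ≤ l → Tendsto (fun k => F k l) atTop (𝓝 (f l))) (a : ℝ)
    (hi : Integrable (fun ω => Real.exp (-(a * h ω)) * w ω) μ) :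
    Tendsto (fun k => ∫ ω, F k (h ω) * (Real.exp (-(a * h ω)) * w ω) ∂μ) atTop
      (𝓝 (∫ ω, f (h ω) * (Real.exp (-(a * h ω)) * w ω) ∂μ)) := by
  apply tendsto_integral_of_dominated_convergence
    (fun ω => M * ‖Real.exp (-(a * h ω)) * w ω‖)
  · intro k
    exact ((hF k).comp hm).aestronglyMeasurable.mul hi.aestronglyMeasurable
  · exact hi.norm.const_mul M
  · intro k
    filter_upwards with ω
    rw [norm_mul]
    exact mul_le_mul_of_nonneg_right (hb k _ (h0 ω)) (norm_nonneg _)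
  · filter_upwards with ω
    exact (hl _ (h0 ω)).mul_const _

/-- truncated mixture of exponentials -/
def gE (s ε l : ℝ) : ℝ := ∫ u in Ioi ε, u ^ (-1 - s) * Real.exp (-(u * l))

lemma k_int {s ε : ℝ} (hs : 0 < s) (hε : 0 < ε) :
    IntegrableOn (fun u : ℝ => u ^ (-1 - s)) (Ioi ε) :=
  integrableOn_Ioi_rpow_of_lt (by linarith) hε

lemma ke_int {s ε l : ℝ} (hs : 0 < s) (hε : 0 < ε) (hl : 0 ≤ l) :
    IntegrableOn (fun u : ℝ => u ^ (-1 - s) * Real.exp (-(u * l))) (Ioi ε) := by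
  apply Integrable.mul_bdd (c := 1) (k_int hs hε)
  · exact (by fun_prop : Measurable fun u : ℝ => Real.exp (-(u * l))).aestronglyMeasurable
  · filter_upwards [ae_restrict_mem measurableSet_Ioi] with u hu
    have : 0 < u := lt_trans hε hu
    rw [Real.norm_eq_abs, abs_of_pos (Real.exp_pos _), Real.exp_le_one_iff]
    nlinarith

lemma gE_meas (s ε : ℝ) : Measurable (gE s ε) := by
  unfold gE
  apply StronglyMeasurable.measurable
  apply StronglyMeasurable.integral_prod_right (f := fun l u => u ^ (-1 - s) * Real.exp (-(u * l)))
  apply Measurable.stronglyMeasurable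
  unfold Function.uncurry
  fun_prop

lemma gE_nonneg {s ε l : ℝ} (hε : 0 < ε) : 0 ≤ gE s ε l := by
  apply setIntegral_nonneg measurableSet_Ioi
  intro u hu
  have : 0 < u := lt_trans hε hu
  positivity

lemma gE_le {s ε l : ℝ} (hs : 0 < s) (hε : 0 < ε) (hl : 0 ≤ l) : gE s ε l ≤ gE s ε 0 := by
  apply setIntegral_mono_on (ke_int hs hε hl) (ke_int hs hε le_rfl) measurableSet_Ioi
  intro u hu
  have : 0 < u := lt_trans hε hu
  apply mul_le_mul_of_nonneg_left _ (by positivity)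
  apply Real.exp_le_exp.2
  nlinarith

lemma fub_one {Ω : Type*} [MeasurableSpace Ω] (μ : Measure Ω) [SFinite μ] (h w : Ω → ℝ)
    (hm : Measurable h) (h0 : ∀ ω, 0 ≤ h ω) (f : ℝ → ℝ)
    (hf : Measurable f) (M : ℝ) (hb : ∀ l, 0 ≤ l → |f l| ≤ M)
    (a : ℝ) (hi : Integrable (fun ω => Real.exp (-(a * h ω)) * w ω) μ)
    {s ε : ℝ} (hs : 0 < s) (hε : 0 < ε) :
    IntegrableOn (fun u => u ^ (-1 - s) *
      ∫ ω, f (h ω) * (Real.exp (-((a + u) * h ω)) * w ω) ∂μ) (Ioi ε) ∧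
    ∫ ω, (gE s ε (h ω) * f (h ω)) * (Real.exp (-(a * h ω)) * w ω) ∂μ =
      ∫ u in Ioi ε, u ^ (-1 - s) *
      ∫ ω, f (h ω) * (Real.exp (-((a + u) * h ω)) * w ω) ∂μ := by
  have hi2 : Integrable (fun ω => f (h ω) * (Real.exp (-(a * h ω)) * w ω)) μ := by
    apply hi.bdd_mul (c := M) (hf.comp hm).aestronglyMeasurable
    filter_upwards with ω using hb _ (h0 ω)
  have hp := hi2.mul_prod (k_int hs hε)
  have hp2 : Integrable (fun z : Ω × ℝ => Real.exp (-(z.2 * h z.1)) *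
      ((f (h z.1) * (Real.exp (-(a * h z.1)) * w z.1)) * z.2 ^ (-1 - s)))
      (μ.prod (volume.restrict (Ioi ε))) := by
    apply hp.bdd_mul (c := 1)
    · exact (by fun_prop : Measurable fun z : Ω × ℝ => Real.exp (-(z.2 * h z.1))).aestronglyMeasurable
    · have : ∀ᵐ z ∂(μ.prod (volume.restrict (Ioi ε))), z.2 ∈ Ioi ε :=
        Measure.quasiMeasurePreserving_snd.ae (ae_restrict_mem measurableSet_Ioi)
      filter_upwards [this] with z hz
      have : 0 < z.2 := lt_trans hε hz
      rw [Real.norm_eq_abs, abs_of_pos (Real.exp_pos _), Real.exp_le_one_iff]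
      nlinarith [h0 z.1, mul_nonneg this.le (h0 z.1)]
  have e1 : ∀ u, u ^ (-1 - s) * ∫ ω, f (h ω) * (Real.exp (-((a + u) * h ω)) * w ω) ∂μ
      = ∫ ω, Real.exp (-(u * h ω)) *
      ((f (h ω) * (Real.exp (-(a * h ω)) * w ω)) * u ^ (-1 - s)) ∂μ := by
    intro u
    rw [← integral_const_mul]
    congr 1; ext ω
    rw [show -((a + u) * h ω) = -(u * h ω) + -(a * h ω) by ring, Real.exp_add]
    ring
  have e2 : ∀ ω, (gE s ε (h ω) * f (h ω)) * (Real.exp (-(a * h ω)) * w ω) =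
      ∫ u in Ioi ε, Real.exp (-(u * h ω)) *
      ((f (h ω) * (Real.exp (-(a * h ω)) * w ω)) * u ^ (-1 - s)) := by
    intro ω
    unfold gE
    rw [mul_assoc, ← integral_mul_const]
    congr 1; ext u
    ring
  constructor
  · simp_rw [e1]
    exact hp2.integral_prod_right
  · simp_rw [e1, e2]
    exact integral_integral_swap hp2

lemma key_split {f : ℝ → ℝ} (hf : Measurable f) {M : ℝ} (hM : ∀ l, 0 ≤ l → |f l| ≤ M)
    {s ε : ℝ} (hs : 0 < s) (hε : 0 < ε) (α β a : ℝ)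
    {Ω : Type*} [MeasurableSpace Ω] (μ : Measure Ω) (h w : Ω → ℝ)
    (hm : Measurable h) (h0 : ∀ ω, 0 ≤ h ω)
    (hi : Integrable (fun ω => Real.exp (-(a * h ω)) * w ω) μ) :
    ∫ ω, ((α + β * gE s ε (h ω)) * f (h ω)) * (Real.exp (-(a * h ω)) * w ω) ∂μ
      = α * ∫ ω, f (h ω) * (Real.exp (-(a * h ω)) * w ω) ∂μ
       + β * ∫ ω, (gE s ε (h ω) * f (h ω)) * (Real.exp (-(a * h ω)) * w ω) ∂μ := by
  rw [← integral_const_mul, ← integral_const_mul, ← integral_add]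
  · congr 1; ext ω; ring
  · apply Integrable.const_mul
    apply hi.bdd_mul (c := M) (hf.comp hm).aestronglyMeasurable
    filter_upwards with ω using hM _ (h0 ω)
  · apply Integrable.const_mul
    apply hi.bdd_mul (c := gE s ε 0 * M)
      (((gE_meas s ε).mul hf).comp hm).aestronglyMeasurable
    filter_upwards with ω
    change ‖gE s ε (h ω) * f (h ω)‖ ≤ _
    rw [norm_mul, Real.norm_eq_abs, Real.norm_eq_abs, abs_of_nonneg (gE_nonneg hε)]
    exact mul_le_mul (gE_le hs hε (h0 ω)) (hM _ (h0 ω)) (abs_nonneg _) (gE_nonneg hε)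

/-- positivity cone -/
structure PP {Ω₁ Ω₂ : Type*} [MeasurableSpace Ω₁] [MeasurableSpace Ω₂] (μ₁ : Measure Ω₁)
    (μ₂ : Measure Ω₂) (h₁ w₁ : Ω₁ → ℝ) (h₂ w₂ : Ω₂ → ℝ) (f : ℝ → ℝ) : Prop where
  meas : Measurable f
  bdd : ∃ M, ∀ l, 0 ≤ l → |f l| ≤ M
  le : ∀ a, 0 < a → ∫ ω, f (h₁ ω) * (Real.exp (-(a * h₁ ω)) * w₁ ω) ∂μ₁ ≤
    ∫ ω, f (h₂ ω) * (Real.exp (-(a * h₂ ω)) * w₂ ω) ∂μ₂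

set_option linter.unusedSectionVars false
section
variable {Ω₁ Ω₂ : Type*} [MeasurableSpace Ω₁] [MeasurableSpace Ω₂] {μ₁ : Measure Ω₁}
    {μ₂ : Measure Ω₂} [SFinite μ₁] [SFinite μ₂] {h₁ w₁ : Ω₁ → ℝ} {h₂ w₂ : Ω₂ → ℝ}

lemma PP.lim {F : ℕ → ℝ → ℝ} {f : ℝ → ℝ} (hm₁ : Measurable h₁) (h0₁ : ∀ ω, 0 ≤ h₁ ω)
    (hm₂ : Measurable h₂) (h0₂ : ∀ ω, 0 ≤ h₂ ω)
    (hi₁ : ∀ a, 0 < a → Integrable (fun ω => Real.exp (-(a * h₁ ω)) * w₁ ω) μ₁)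
    (hi₂ : ∀ a, 0 < a → Integrable (fun ω => Real.exp (-(a * h₂ ω)) * w₂ ω) μ₂)
    (hF : ∀ k, PP μ₁ μ₂ h₁ w₁ h₂ w₂ (F k)) (hf : Measurable f) (M : ℝ)
    (hb : ∀ k, ∀ l, 0 ≤ l → |F k l| ≤ M)
    (hl : ∀ l, 0 ≤ l → Tendsto (fun k => F k l) atTop (𝓝 (f l))) :
    PP μ₁ μ₂ h₁ w₁ h₂ w₂ f := by
  refine ⟨hf, ⟨M, ?_⟩, ?_⟩
  · intro l h
    exact le_of_tendsto (hl l h).abs (Eventually.of_forall fun k => hb k l h)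
  · intro a ha
    exact le_of_tendsto_of_tendsto'
      (lim_one μ₁ h₁ w₁ hm₁ h0₁ F f (fun k => (hF k).meas) M hb hl a (hi₁ a ha))
      (lim_one μ₂ h₂ w₂ hm₂ h0₂ F f (fun k => (hF k).meas) M hb hl a (hi₂ a ha))
      (fun k => (hF k).le a ha)

lemma PP.step {f : ℝ → ℝ} (hm₁ : Measurable h₁) (h0₁ : ∀ ω, 0 ≤ h₁ ω)
    (hm₂ : Measurable h₂) (h0₂ : ∀ ω, 0 ≤ h₂ ω)
    (hi₁ : ∀ a, 0 < a → Integrable (fun ω => Real.exp (-(a * h₁ ω)) * w₁ ω) μ₁)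
    (hi₂ : ∀ a, 0 < a → Integrable (fun ω => Real.exp (-(a * h₂ ω)) * w₂ ω) μ₂)
    (hf : PP μ₁ μ₂ h₁ w₁ h₂ w₂ f) {s ε α β : ℝ} (hs : 0 < s) (hε : 0 < ε)
    (hα : 0 ≤ α) (hβ : 0 ≤ β) :
    PP μ₁ μ₂ h₁ w₁ h₂ w₂ (fun l => (α + β * gE s ε l) * f l) := by
  obtain ⟨M, hM⟩ := hf.bdd
  have hM0 : 0 ≤ M := (abs_nonneg _).trans (hM 0 le_rfl)
  refine ⟨(((gE_meas s ε).const_mul β).const_add α).mul hf.meas,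
    ⟨(α + β * gE s ε 0) * M, ?_⟩, ?_⟩
  · intro l hl
    have h1 := gE_nonneg (s := s) (l := l) hε
    have h2 := gE_le hs hε hl
    rw [abs_mul, abs_of_nonneg (by positivity)]
    have h3 : 0 ≤ gE s ε 0 := gE_nonneg hε
    have h4 := hM l hl
    gcongr
  · intro a ha
    have key1 := key_split hf.meas hM hs hε α β a μ₁ h₁ w₁ hm₁ h0₁ (hi₁ a ha)
    have key2 := key_split hf.meas hM hs hε α β a μ₂ h₂ w₂ hm₂ h0₂ (hi₂ a ha)
    rw [key1, key2]
    obtain ⟨i1, e1⟩ := fub_one μ₁ h₁ w₁ hm₁ h0₁ f hf.meas M hM a (hi₁ a ha) hs hε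
    obtain ⟨i2, e2⟩ := fub_one μ₂ h₂ w₂ hm₂ h0₂ f hf.meas M hM a (hi₂ a ha) hs hε
    rw [e1, e2]
    apply add_le_add
    · exact mul_le_mul_of_nonneg_left (hf.le a ha) hα
    · apply mul_le_mul_of_nonneg_left _ hβ
      apply setIntegral_mono_on i1 i2 measurableSet_Ioi
      intro u hu
      have : 0 < u := lt_trans hε hu
      exact mul_le_mul_of_nonneg_left (hf.le _ (by linarith)) (by positivity)


/-- the normalising constant -/
def cS (s : ℝ) : ℝ := ∫ u in Ioi (0:ℝ), u ^ (-1 - s) * (1 - Real.exp (-u))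

lemma c_int {s l : ℝ} (hs : s ∈ Ioo (0:ℝ) 1) (hl : 0 ≤ l) :
    IntegrableOn (fun u : ℝ => u ^ (-1 - s) * (1 - Real.exp (-(u * l)))) (Ioi 0) := by
  rw [← Ioc_union_Ioi_eq_Ioi (zero_le_one (α := ℝ))]
  have hmeas : Measurable (fun u : ℝ => u ^ (-1 - s) * (1 - Real.exp (-(u * l)))) := by fun_prop
  apply IntegrableOn.union
  · have h1 : IntegrableOn (fun u : ℝ => l * u ^ (-s)) (Ioc 0 1) := by
      apply Integrable.const_mul
      have := intervalIntegral.intervalIntegrable_rpow' (a := 0) (b := 1) (r := -s) (by linarith [hs.2])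
      rwa [intervalIntegrable_iff_integrableOn_Ioc_of_le zero_le_one] at this
    apply Integrable.mono' h1 hmeas.aestronglyMeasurable
    filter_upwards [ae_restrict_mem measurableSet_Ioc] with u hu
    have hu0 : 0 < u := hu.1
    have h2 : 0 ≤ u * l := by positivity
    have h3 : Real.exp (-(u * l)) ≤ 1 := Real.exp_le_one_iff.2 (by linarith)
    have h4 := Real.add_one_le_exp (-(u * l))
    rw [Real.norm_eq_abs, abs_of_nonneg (mul_nonneg (by positivity) (by linarith))]
    calc u ^ (-1 - s) * (1 - Real.exp (-(u * l))) ≤ u ^ (-1 - s) * (u * l) := by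
          gcongr; linarith
      _ = l * (u ^ (-1 - s) * u ^ (1:ℝ)) := by rw [Real.rpow_one]; ring
      _ = l * u ^ (-s) := by rw [← Real.rpow_add hu0]; congr 2; ring
  · apply Integrable.mul_bdd (c := 1) (k_int hs.1 one_pos)
    · exact (by fun_prop : Measurable fun u : ℝ => 1 - Real.exp (-(u * l))).aestronglyMeasurable
    filter_upwards [ae_restrict_mem measurableSet_Ioi] with u hu
    have hu0 : 0 < u := lt_trans one_pos hu
    have h2 : 0 ≤ u * l := by positivity
    have h3 : Real.exp (-(u * l)) ≤ 1 := Real.exp_le_one_iff.2 (by linarith)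
    have h4 := Real.exp_pos (-(u * l))
    rw [Real.norm_eq_abs, abs_le]; constructor <;> linarith

lemma cS_pos {s : ℝ} (hs : s ∈ Ioo (0:ℝ) 1) : 0 < cS s := by
  unfold cS
  have hi := c_int hs zero_le_one
  simp only [mul_one] at hi
  have hp : ∀ u ∈ Ioi (0:ℝ), 0 < u ^ (-1 - s) * (1 - Real.exp (-u)) := by
    intro u hu
    have hu0 : 0 < u := hu
    have h3 : Real.exp (-u) < 1 := by rw [← Real.exp_zero]; exact Real.exp_lt_exp.2 (by linarith)
    exact mul_pos (by positivity) (by linarith)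
  rw [setIntegral_pos_iff_support_of_nonneg_ae _ hi]
  · refine lt_of_lt_of_le ?_ (measure_mono (s := Ioi (0:ℝ)) ?_)
    · simp
    · intro u hu
      exact ⟨(hp u hu).ne', hu⟩
  · filter_upwards [ae_restrict_mem measurableSet_Ioi] with u hu using (hp u hu).le

lemma c_scale {s l : ℝ} (hs : s ∈ Ioo (0:ℝ) 1) (hl : 0 ≤ l) :
    ∫ u in Ioi (0:ℝ), u ^ (-1 - s) * (1 - Real.exp (-(u * l))) = cS s * l ^ s := by
  rcases hl.eq_or_lt with rfl | hl
  · simp [Real.zero_rpow hs.1.ne']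
  have := integral_comp_mul_right_Ioi' (fun u : ℝ => u ^ (-1 - s) * (1 - Real.exp (-u))) 0 hl
  rw [zero_mul, smul_eq_mul, ← integral_const_mul] at this
  unfold cS
  rw [← this, ← integral_mul_const]
  apply setIntegral_congr_fun measurableSet_Ioi
  intro u hu
  have hu0 : 0 < u := hu
  simp only
  rw [Real.mul_rpow hu0.le hl.le]
  have : l * l ^ (-1 - s) * l ^ s = 1 := by
    nth_rewrite 1 [← Real.rpow_one l]
    rw [← Real.rpow_add hl, ← Real.rpow_add hl, show 1 + (-1 - s) + s = 0 by ring, Real.rpow_zero]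
  linear_combination (- u ^ (-1 - s) * (1 - Real.exp (-(u * l)))) * this

lemma gE_lim {s l : ℝ} (hs : s ∈ Ioo (0:ℝ) 1) (hl : 0 ≤ l) :
    Tendsto (fun k : ℕ => gE s (1 / ((k:ℝ) + 1)) 0 - gE s (1 / ((k:ℝ) + 1)) l) atTop
      (𝓝 (cS s * l ^ s)) := by
  rw [← c_scale hs hl]
  have hU : ⋃ k : ℕ, Ioi (1 / ((k:ℝ) + 1)) = Ioi 0 := by
    ext x
    simp only [mem_iUnion, mem_Ioi]
    constructor
    · rintro ⟨k, hk⟩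
      exact lt_trans (by positivity) hk
    · intro hx
      exact exists_nat_one_div_lt hx
  have hmono : Monotone fun k : ℕ => Ioi (1 / ((k:ℝ) + 1)) := by
    intro i j hij
    apply Ioi_subset_Ioi
    gcongr
  have := tendsto_setIntegral_of_monotone (μ := volume)
    (f := fun u : ℝ => u ^ (-1 - s) * (1 - Real.exp (-(u * l))))
    (fun k : ℕ => measurableSet_Ioi) hmono (by rw [hU]; exact c_int hs hl)
  rw [hU] at this
  refine this.congr fun k => ?_
  have hk : 0 < 1 / ((k:ℝ) + 1) := by positivity
  unfold gE
  rw [← integral_sub (ke_int hs.1 hk le_rfl) (ke_int hs.1 hk hl)]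
  congr 1; ext u
  simp; ring

lemma PP.pow (hm₁ : Measurable h₁) (h0₁ : ∀ ω, 0 ≤ h₁ ω)
    (hm₂ : Measurable h₂) (h0₂ : ∀ ω, 0 ≤ h₂ ω)
    (hi₁ : ∀ a, 0 < a → Integrable (fun ω => Real.exp (-(a * h₁ ω)) * w₁ ω) μ₁)
    (hi₂ : ∀ a, 0 < a → Integrable (fun ω => Real.exp (-(a * h₂ ω)) * w₂ ω) μ₂)
    (hf : PP μ₁ μ₂ h₁ w₁ h₂ w₂ (fun _ => 1)) {s ε α β : ℝ} (hs : 0 < s) (hε : 0 < ε)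
    (hα : 0 ≤ α) (hβ : 0 ≤ β) (k : ℕ) :
    PP μ₁ μ₂ h₁ w₁ h₂ w₂ (fun l => (α + β * gE s ε l) ^ k) := by
  induction k with
  | zero => simpa using hf
  | succ k ih =>
    simp_rw [pow_succ']
    exact PP.step hm₁ h0₁ hm₂ h0₂ hi₁ hi₂ ih hs hε hα hβ

lemma PP.expE (hm₁ : Measurable h₁) (h0₁ : ∀ ω, 0 ≤ h₁ ω)
    (hm₂ : Measurable h₂) (h0₂ : ∀ ω, 0 ≤ h₂ ω)
    (hi₁ : ∀ a, 0 < a → Integrable (fun ω => Real.exp (-(a * h₁ ω)) * w₁ ω) μ₁)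
    (hi₂ : ∀ a, 0 < a → Integrable (fun ω => Real.exp (-(a * h₂ ω)) * w₂ ω) μ₂)
    (hf : PP μ₁ μ₂ h₁ w₁ h₂ w₂ (fun _ => 1)) {s ε t : ℝ} (hs : 0 < s) (hε : 0 < ε)
    (ht : 0 ≤ t) :
    PP μ₁ μ₂ h₁ w₁ h₂ w₂ (fun l => Real.exp (-(t * (gE s ε 0 - gE s ε l)))) := by
  obtain ⟨N, hN⟩ := exists_nat_gt (t * gE s ε 0)
  have hg0 : 0 ≤ gE s ε 0 := gE_nonneg hε
  have hN0 : (0:ℝ) < N := lt_of_le_of_lt (by positivity) hN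
  have hK : ∀ k : ℕ, 0 < ((k + N : ℕ) : ℝ) ∧ t * gE s ε 0 ≤ ((k + N : ℕ) : ℝ) := by
    intro k
    push_cast
    constructor
    · positivity
    · have : (0:ℝ) ≤ k := by positivity
      linarith
  have hα : ∀ k : ℕ, 0 ≤ 1 - t / ((k + N : ℕ) : ℝ) * gE s ε 0 := by
    intro k
    rw [div_mul_eq_mul_div, sub_nonneg, div_le_one (hK k).1]
    exact (hK k).2
  apply PP.lim (F := fun k l => ((1 - t / ((k + N : ℕ) : ℝ) * gE s ε 0)
    + t / ((k + N : ℕ) : ℝ) * gE s ε l) ^ (k + N)) hm₁ h0₁ hm₂ h0₂ hi₁ hi₂ ?_ ?_ 1 ?_ ?_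
  · intro k
    apply PP.pow hm₁ h0₁ hm₂ h0₂ hi₁ hi₂ hf hs hε (hα k)
    have := (hK k).1
    positivity
  · have := gE_meas s ε
    fun_prop
  · intro k l hl
    have h1 := (hK k).1
    have h2 := hα k
    have h3 : 0 ≤ gE s ε l := gE_nonneg hε
    have h4 := gE_le hs hε hl
    have h5 : 0 ≤ t / ((k + N : ℕ) : ℝ) := by positivity
    rw [abs_of_nonneg (by positivity)]
    apply pow_le_one₀ (by positivity)
    nlinarith
  · intro l hl
    have := (Real.tendsto_one_add_div_pow_exp (-(t * (gE s ε 0 - gE s ε l)))).comp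
      (tendsto_add_atTop_nat N)
    refine this.congr fun k => ?_
    simp only [Function.comp]
    congr 1
    ring

lemma PP.main (hm₁ : Measurable h₁) (h0₁ : ∀ ω, 0 ≤ h₁ ω)
    (hm₂ : Measurable h₂) (h0₂ : ∀ ω, 0 ≤ h₂ ω)
    (hi₁ : ∀ a, 0 < a → Integrable (fun ω => Real.exp (-(a * h₁ ω)) * w₁ ω) μ₁)
    (hi₂ : ∀ a, 0 < a → Integrable (fun ω => Real.exp (-(a * h₂ ω)) * w₂ ω) μ₂)
    (hf : ∀ a, 0 < a → ∫ ω, (Real.exp (-(a * h₁ ω)) * w₁ ω) ∂μ₁ ≤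
      ∫ ω, (Real.exp (-(a * h₂ ω)) * w₂ ω) ∂μ₂)
    {s t : ℝ} (hs : s ∈ Ioo (0:ℝ) 1) (ht : 0 ≤ t) (a : ℝ) (ha : 0 < a) :
    ∫ ω, Real.exp (-(t * h₁ ω ^ s)) * (Real.exp (-(a * h₁ ω)) * w₁ ω) ∂μ₁ ≤
    ∫ ω, Real.exp (-(t * h₂ ω ^ s)) * (Real.exp (-(a * h₂ ω)) * w₂ ω) ∂μ₂ := by
  have hc := cS_pos hs
  have h1 : PP μ₁ μ₂ h₁ w₁ h₂ w₂ (fun _ => 1) :=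
    ⟨measurable_const, ⟨1, by simp⟩, by simpa using hf⟩
  have h2 : PP μ₁ μ₂ h₁ w₁ h₂ w₂ (fun l => Real.exp (-(t * l ^ s))) := by
    apply PP.lim (F := fun (k : ℕ) l => Real.exp (-(t / cS s *
      (gE s (1 / ((k:ℝ) + 1)) 0 - gE s (1 / ((k:ℝ) + 1)) l)))) hm₁ h0₁ hm₂ h0₂ hi₁ hi₂ ?_ ?_ 1 ?_ ?_
    · intro k
      exact PP.expE hm₁ h0₁ hm₂ h0₂ hi₁ hi₂ h1 hs.1 (by positivity) (by positivity)
    · fun_prop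
    · intro k l hl
      have h4 := gE_le hs.1 (by positivity : 0 < 1 / ((k:ℝ) + 1)) hl
      rw [abs_of_pos (Real.exp_pos _), Real.exp_le_one_iff]
      have : 0 ≤ t / cS s := by positivity
      nlinarith
    · intro l hl
      have := ((gE_lim hs hl).const_mul (t / cS s)).neg.rexp
      convert this using 3
      field_simp
  exact h2.le a ha
end

section concrete
variable {n : ℕ}

lemma exp_re_aux (A B : ℝ) : (Complex.exp ((A:ℂ) + (B:ℂ) * Complex.I)).re =
    Real.exp A * Real.cos B := by
  rw [Complex.exp_re]
  simp

lemma exp_norm_aux (A B : ℝ) : ‖Complex.exp ((A:ℂ) + (B:ℂ) * Complex.I)‖ = Real.exp A := by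
  rw [Complex.norm_exp]
  simp

lemma gauss_int (x : EuclideanSpace ℝ (Fin n)) {a : ℝ} (ha : 0 < a) :
    Integrable (fun ξ : EuclideanSpace ℝ (Fin n) =>
      Real.exp (-(a * ‖ξ‖ ^ 2)) * Real.cos (2 * Real.pi * ⟪x, ξ⟫)) ∧
    ∫ ξ : EuclideanSpace ℝ (Fin n), Real.exp (-(a * ‖ξ‖ ^ 2)) * Real.cos (2 * Real.pi * ⟪x, ξ⟫)
      = (Real.pi / a) ^ ((n:ℝ) / 2) * Real.exp (-(Real.pi ^ 2 * (‖x‖ ^ 2 / a))) := by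
  have hb : 0 < (a : ℂ).re := by simpa using ha
  have h1 := GaussianFourier.integrable_cexp_neg_mul_sq_norm_add hb (2 * Real.pi * Complex.I) x
  have h2 := GaussianFourier.integral_cexp_neg_mul_sq_norm_add hb (2 * Real.pi * Complex.I) x
  have e : ∀ ξ : EuclideanSpace ℝ (Fin n), (Complex.exp (-(a:ℂ) * (‖ξ‖:ℂ) ^ 2
      + 2 * Real.pi * Complex.I * ((⟪x, ξ⟫ : ℝ) : ℂ))).re
      = Real.exp (-(a * ‖ξ‖ ^ 2)) * Real.cos (2 * Real.pi * ⟪x, ξ⟫) := by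
    intro ξ
    rw [show -(a:ℂ) * (‖ξ‖:ℂ) ^ 2 + 2 * Real.pi * Complex.I * ((⟪x, ξ⟫ : ℝ) : ℂ)
      = ((-(a * ‖ξ‖ ^ 2) : ℝ) : ℂ) + ((2 * Real.pi * ⟪x, ξ⟫ : ℝ) : ℂ) * Complex.I by
        push_cast; ring]
    exact exp_re_aux _ _
  constructor
  · have := h1.re
    simp only [RCLike.re_to_complex, e] at this
    exact this
  · have h3 := integral_re h1
    simp only [RCLike.re_to_complex, e] at h3
    rw [h3, h2]
    rw [show ((Real.pi:ℂ) / a) ^ ((Module.finrank ℝ (EuclideanSpace ℝ (Fin n)) : ℂ) / 2) *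
      Complex.exp ((2 * Real.pi * Complex.I) ^ 2 * (‖x‖:ℂ) ^ 2 / (4 * a)) =
      (((Real.pi / a) ^ ((n:ℝ) / 2) * Real.exp (-(Real.pi ^ 2 * (‖x‖ ^ 2 / a))) : ℝ) : ℂ) by
        rw [finrank_euclideanSpace, Fintype.card_fin]
        push_cast
        rw [Complex.ofReal_cpow (by positivity)]
        push_cast
        congr 2
        rw [mul_pow, Complex.I_sq]
        have : (a:ℂ) ≠ 0 := by exact_mod_cast ha.ne'
        field_simp
        ring]
    exact Complex.ofReal_re _

lemma sq_rpow (r s : ℝ) (hr : 0 ≤ r) : (r ^ 2) ^ s = r ^ (2 * s) := by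
  rw [Real.rpow_mul hr, Real.rpow_two]

lemma H_eq (s : ℝ) (x : EuclideanSpace ℝ (Fin n)) {t : ℝ} (ht : 0 < t) :
    mixedHeatKernel n s x t = ∫ ξ : EuclideanSpace ℝ (Fin n),
      Real.exp (-(t * (‖ξ‖ ^ 2) ^ s)) *
        (Real.exp (-(t * ‖ξ‖ ^ 2)) * Real.cos (2 * Real.pi * ⟪x, ξ⟫)) := by
  unfold mixedHeatKernel
  have e : ∀ ξ : EuclideanSpace ℝ (Fin n),
      -(t : ℂ) * ((‖ξ‖ ^ 2 + ‖ξ‖ ^ (2 * s) : ℝ) : ℂ)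
      + 2 * (Real.pi : ℂ) * Complex.I * ((⟪x, ξ⟫ : ℝ) : ℂ) =
      ((-(t * (‖ξ‖ ^ 2) ^ s) + -(t * ‖ξ‖ ^ 2) : ℝ) : ℂ)
        + ((2 * Real.pi * ⟪x, ξ⟫ : ℝ) : ℂ) * Complex.I := by
    intro ξ
    rw [sq_rpow _ _ (norm_nonneg _)]
    push_cast; ring
  simp_rw [e]
  have hi : Integrable (fun ξ : EuclideanSpace ℝ (Fin n) =>
      Complex.exp (((-(t * (‖ξ‖ ^ 2) ^ s) + -(t * ‖ξ‖ ^ 2) : ℝ) : ℂ)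
        + ((2 * Real.pi * ⟪x, ξ⟫ : ℝ) : ℂ) * Complex.I)) := by
    have hg := (gauss_int (0 : EuclideanSpace ℝ (Fin n)) ht).1
    simp only [inner_zero_left, mul_zero, Real.cos_zero, mul_one] at hg
    apply Integrable.mono' hg
    · apply Measurable.aestronglyMeasurable
      fun_prop
    · filter_upwards with ξ
      rw [exp_norm_aux]
      apply Real.exp_le_exp.2
      have : 0 ≤ t * (‖ξ‖ ^ 2) ^ s := by positivity
      linarith
  have h3 := integral_re hi
  simp only [RCLike.re_to_complex] at h3
  rw [← h3]
  congr 1; ext ξ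
  rw [← mul_assoc, ← Real.exp_add]
  exact exp_re_aux _ _

lemma H_nonneg {s : ℝ} (hs : s ∈ Ioo (0:ℝ) 1) (x : EuclideanSpace ℝ (Fin n)) {t : ℝ}
    (ht : 0 < t) : 0 ≤ mixedHeatKernel n s x t := by
  rw [H_eq s x ht]
  have := PP.main (μ₁ := (0 : Measure ℝ)) (μ₂ := (volume : Measure (EuclideanSpace ℝ (Fin n))))
    (h₁ := fun _ => 0) (w₁ := fun _ => 0)
    (h₂ := fun ξ => ‖ξ‖ ^ 2) (w₂ := fun ξ => Real.cos (2 * Real.pi * ⟪x, ξ⟫))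
    (by fun_prop) (by simp) (by fun_prop) (fun ξ => by positivity) (by simp)
    (fun a ha => (gauss_int x ha).1) (fun a ha => by
      rw [(gauss_int x ha).2]; simp; positivity) hs ht.le t ht
  simpa using this

/-- constant in the Gaussian comparison -/
def CN (n : ℕ) : ℝ := (Real.pi * n) ^ ((n:ℝ) / 2) / Real.Gamma ((n:ℝ) / 2)

lemma CN_pos (hn : 0 < n) : 0 < CN n := by
  have h : (0:ℝ) < n := by exact_mod_cast hn
  have := Real.Gamma_pos_of_pos (half_pos h)
  unfold CN
  positivity

lemma pe_int {q r : ℝ} (hq : 0 < q) (hr : 0 < r) :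
    IntegrableOn (fun p : ℝ => p ^ (q - 1) * Real.exp (-(r * p))) (Ioi 0) := by
  have := integrableOn_rpow_mul_exp_neg_mul_rpow (p := 1) (s := q - 1) (b := r)
    (by linarith) one_pos hr
  simpa using this

lemma gauss_le (hn : 0 < n) (R : ℝ) (hR : 0 ≤ R) {a : ℝ} (ha : 0 < a) :
    (Real.pi / a) ^ ((n:ℝ) / 2) * Real.exp (-(Real.pi ^ 2 * (R / a)))
      ≤ CN n * ∫ p in Ioi (0:ℝ), p ^ ((n:ℝ) / 2 - 1) * Real.exp (-((R + a) * p)) := by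
  have h : (0:ℝ) < n := by exact_mod_cast hn
  have h1 : (1:ℝ) ≤ n := by exact_mod_cast hn
  rw [Real.integral_rpow_mul_exp_neg_mul_Ioi (half_pos h) (by positivity)]
  have hG := Real.Gamma_pos_of_pos (half_pos h)
  unfold CN
  rw [show (Real.pi * n) ^ ((n:ℝ) / 2) / Real.Gamma ((n:ℝ) / 2) *
    ((1 / (R + a)) ^ ((n:ℝ) / 2) * Real.Gamma ((n:ℝ) / 2)) =
    (Real.pi * n) ^ ((n:ℝ) / 2) * (1 / (R + a)) ^ ((n:ℝ) / 2) by field_simp]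
  rw [← Real.mul_rpow (by positivity) (by positivity)]
  set y := R / a with hy
  have hy0 : 0 ≤ y := by positivity
  have e : Real.pi * n * (1 / (R + a)) = Real.pi / a * (n / (1 + y)) := by
    rw [hy]; field_simp; ring
  rw [e, Real.mul_rpow (by positivity) (by positivity)]
  apply mul_le_mul_of_nonneg_left _ (by positivity)
  have h2 : 1 + y ≤ n * Real.exp (y / n) := by
    have := Real.add_one_le_exp (y / n)
    calc 1 + y ≤ n + y := by linarith
      _ = n * (y / n + 1) := by field_simp; ring
      _ ≤ _ := by gcongr
  have h3 : Real.exp (-(y / n)) ≤ n / (1 + y) := by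
    rw [Real.exp_neg, le_div_iff₀ (by positivity), inv_mul_le_iff₀ (Real.exp_pos _)]
    linarith
  calc Real.exp (-(Real.pi ^ 2 * y)) ≤ Real.exp (-(y / n) * (n / 2)) := by
        apply Real.exp_le_exp.2
        have : -(y / n) * ((n:ℝ) / 2) = - (y / 2) := by field_simp
        rw [this]
        have h5 : 1 / 2 ≤ Real.pi ^ 2 := by nlinarith [Real.pi_gt_three]
        nlinarith [mul_le_mul_of_nonneg_right h5 hy0]
    _ = Real.exp (-(y / n)) ^ ((n:ℝ) / 2) := by rw [Real.exp_mul]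
    _ ≤ _ := by gcongr

lemma H_le (hn : 0 < n) {s : ℝ} (hs : s ∈ Ioo (0:ℝ) 1) (x : EuclideanSpace ℝ (Fin n)) {t : ℝ}
    (ht : 0 < t) (hx : x ≠ 0) : mixedHeatKernel n s x t ≤
      ∫ p in Ioi (0:ℝ), CN n * (p ^ ((n:ℝ) / 2 - 1) * Real.exp (-(‖x‖ ^ 2 * p))) *
        Real.exp (-(t * p ^ s)) := by
  have h : (0:ℝ) < n := by exact_mod_cast hn
  have hx2 : 0 < ‖x‖ ^ 2 := by have := norm_pos_iff.2 hx; positivity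
  rw [H_eq s x ht]
  have ee : ∀ a : ℝ, ∀ p ∈ Ioi (0:ℝ), Real.exp (-(a * |p|)) *
        (CN n * (p ^ ((n:ℝ) / 2 - 1) * Real.exp (-(‖x‖ ^ 2 * p)))) =
        CN n * (p ^ ((n:ℝ) / 2 - 1) * Real.exp (-((‖x‖ ^ 2 + a) * p))) := by
    intro a p hp
    rw [abs_of_pos hp, show -((‖x‖ ^ 2 + a) * p) = -(a * p) + -(‖x‖ ^ 2 * p) by ring, Real.exp_add]
    ring
  have hint : ∀ a : ℝ, 0 < a → IntegrableOn (fun p : ℝ => Real.exp (-(a * |p|)) *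
        (CN n * (p ^ ((n:ℝ) / 2 - 1) * Real.exp (-(‖x‖ ^ 2 * p))))) (Ioi 0) := by
    intro a ha
    refine IntegrableOn.congr_fun ?_ (fun p hp => (ee a p hp).symm) measurableSet_Ioi
    apply Integrable.const_mul
    exact pe_int (half_pos h) (by positivity)
  have := PP.main (μ₁ := (volume : Measure (EuclideanSpace ℝ (Fin n))))
    (μ₂ := (volume.restrict (Ioi (0:ℝ))))
    (h₁ := fun ξ => ‖ξ‖ ^ 2) (w₁ := fun ξ => Real.cos (2 * Real.pi * ⟪x, ξ⟫))
    (h₂ := fun p => |p|)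
    (w₂ := fun p => CN n * (p ^ ((n:ℝ) / 2 - 1) * Real.exp (-(‖x‖ ^ 2 * p))))
    (by fun_prop) (fun ξ => by positivity) (by fun_prop) (fun p => abs_nonneg p)
    (fun a ha => (gauss_int x ha).1) hint (fun a ha => by
      rw [(gauss_int x ha).2, setIntegral_congr_fun measurableSet_Ioi (ee a), integral_const_mul]
      exact gauss_le hn _ (by positivity) ha) hs ht.le t ht
  refine this.trans ?_
  have hC := CN_pos hn
  have hb : IntegrableOn (fun p : ℝ => CN n * (p ^ ((n:ℝ) / 2 - 1) * Real.exp (-(‖x‖ ^ 2 * p))))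
      (Ioi 0) := (pe_int (half_pos h) hx2).const_mul _
  apply setIntegral_mono_on
  · apply (hint t ht).bdd_mul (c := 1)
    · apply Measurable.aestronglyMeasurable
      fun_prop
    · filter_upwards with p
      rw [Real.norm_eq_abs, abs_of_pos (Real.exp_pos _), Real.exp_le_one_iff]
      have : 0 ≤ t * |p| ^ s := by positivity
      linarith
  · apply hb.mul_bdd (c := 1)
    · apply Measurable.aestronglyMeasurable
      fun_prop
    · filter_upwards [ae_restrict_mem measurableSet_Ioi] with p hp
      rw [Real.norm_eq_abs, abs_of_pos (Real.exp_pos _), Real.exp_le_one_iff]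
      have hp : 0 < p := hp
      have : 0 ≤ t * p ^ s := by positivity
      linarith
  · exact measurableSet_Ioi
  · intro p hp
    have hp : 0 < p := hp
    rw [abs_of_pos hp, mul_comm]
    apply mul_le_mul_of_nonneg_right _ (Real.exp_pos _).le
    apply mul_le_of_le_one_left (by positivity)
    rw [Real.exp_le_one_iff]
    have : 0 ≤ t * p := by positivity
    linarith

lemma bound_int (hn : 4 < n) {s : ℝ} (hs : s ∈ Ioo (0:ℝ) 1) (x : EuclideanSpace ℝ (Fin n))
    (hx : x ≠ 0) :
    IntegrableOn (fun t => ∫ p in Ioi (0:ℝ),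
      CN n * (p ^ ((n:ℝ) / 2 - 1) * Real.exp (-(‖x‖ ^ 2 * p))) * Real.exp (-(t * p ^ s))) (Ioi 0) ∧
    ∫ t in Ioi (0:ℝ), ∫ p in Ioi (0:ℝ),
      CN n * (p ^ ((n:ℝ) / 2 - 1) * Real.exp (-(‖x‖ ^ 2 * p))) * Real.exp (-(t * p ^ s))
      = CN n * Real.Gamma ((n:ℝ) / 2 - s) * ‖x‖ ^ (-((n:ℝ) - 2 * s)) := by
  have h : (4:ℝ) < n := by exact_mod_cast hn
  have hC := CN_pos (n := n) (by omega)
  have hx1 := norm_pos_iff.2 hx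
  have hx2 : 0 < ‖x‖ ^ 2 := by positivity
  have hq : 0 < (n:ℝ) / 2 - s := by linarith [hs.2]
  have it : ∀ p : ℝ, 0 < p → IntegrableOn (fun t : ℝ => Real.exp (-(t * p ^ s))) (Ioi 0) ∧
      ∫ t in Ioi (0:ℝ), Real.exp (-(t * p ^ s)) = p ^ (-s) := by
    intro p hp
    have hps : 0 < p ^ s := by positivity
    constructor
    · have := pe_int one_pos hps
      simpa [mul_comm] using this
    · have := Real.integral_rpow_mul_exp_neg_mul_Ioi one_pos hps
      simp only [sub_self, Real.rpow_zero, one_mul, Real.rpow_one, Real.Gamma_one, mul_one] at this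
      rw [Real.rpow_neg hp.le, ← one_div, ← this]
      simp_rw [mul_comm]
  have ep : ∀ p ∈ Ioi (0:ℝ), ∫ t in Ioi (0:ℝ),
      CN n * (p ^ ((n:ℝ) / 2 - 1) * Real.exp (-(‖x‖ ^ 2 * p))) * Real.exp (-(t * p ^ s)) =
      CN n * (p ^ ((n:ℝ) / 2 - s - 1) * Real.exp (-(‖x‖ ^ 2 * p))) := by
    intro p hp
    have hp : 0 < p := hp
    rw [integral_const_mul, (it p hp).2,
      show (n:ℝ) / 2 - s - 1 = ((n:ℝ) / 2 - 1) + -s by ring, Real.rpow_add hp]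
    ring
  have hprod : Integrable (fun z : ℝ × ℝ =>
      CN n * (z.1 ^ ((n:ℝ) / 2 - 1) * Real.exp (-(‖x‖ ^ 2 * z.1))) * Real.exp (-(z.2 * z.1 ^ s)))
      ((volume.restrict (Ioi (0:ℝ))).prod (volume.restrict (Ioi (0:ℝ)))) := by
    rw [integrable_prod_iff]
    · constructor
      · filter_upwards [ae_restrict_mem measurableSet_Ioi] with p hp
        exact (it p hp).1.const_mul _
      · refine Integrable.congr (f := fun p => CN n * (p ^ ((n:ℝ) / 2 - s - 1) *
          Real.exp (-(‖x‖ ^ 2 * p)))) ?_ ?_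
        · exact (pe_int hq hx2).const_mul _
        · filter_upwards [ae_restrict_mem measurableSet_Ioi] with p hp
          rw [← ep p hp]
          congr 1; ext t
          have hp : 0 < p := hp
          rw [Real.norm_eq_abs, abs_of_nonneg (by positivity)]
    · apply Measurable.aestronglyMeasurable
      fun_prop
  constructor
  · exact hprod.integral_prod_right
  · rw [← integral_integral_swap hprod, setIntegral_congr_fun measurableSet_Ioi ep,
      integral_const_mul, Real.integral_rpow_mul_exp_neg_mul_Ioi hq hx2]
    rw [one_div, Real.inv_rpow hx2.le, sq_rpow _ _ hx1.le, ← Real.rpow_neg hx1.le]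
    rw [show -(2 * ((n:ℝ) / 2 - s)) = -((n:ℝ) - 2 * s) by ring]
    ring

lemma H_meas (n : ℕ) (s : ℝ) : Measurable
    (fun z : EuclideanSpace ℝ (Fin n) × ℝ => mixedHeatKernel n s z.1 z.2) := by
  unfold mixedHeatKernel
  apply Complex.measurable_re.comp
  apply StronglyMeasurable.measurable
  apply StronglyMeasurable.integral_prod_right
    (f := fun (z : EuclideanSpace ℝ (Fin n) × ℝ) (ξ : EuclideanSpace ℝ (Fin n)) =>
     Complex.exp (-(z.2 : ℂ) * ((‖ξ‖ ^ 2 + ‖ξ‖ ^ (2 * s) : ℝ) : ℂ)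
      + 2 * (Real.pi : ℂ) * Complex.I * ((⟪z.1, ξ⟫ : ℝ) : ℂ)))
  apply Measurable.stronglyMeasurable
  unfold Function.uncurry
  fun_prop

lemma Z_meas (n : ℕ) (s : ℝ) : Measurable (mixedZ n s) := by
  unfold mixedZ
  apply StronglyMeasurable.measurable
  apply StronglyMeasurable.integral_prod_right
    (f := fun (x : EuclideanSpace ℝ (Fin n)) => mixedHeatKernel n s x)
  exact (H_meas n s).stronglyMeasurable

lemma Z_bound (hn : 4 < n) {s : ℝ} (hs : s ∈ Ioo (0:ℝ) 1) (x : EuclideanSpace ℝ (Fin n))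
    (hx : x ≠ 0) :
    IntegrableOn (fun t => mixedHeatKernel n s x t) (Ioi 0) ∧
    mixedZ n s x ≤ CN n * Real.Gamma ((n:ℝ) / 2 - s) * ‖x‖ ^ (-((n:ℝ) - 2 * s)) := by
  obtain ⟨h1, h2⟩ := bound_int hn hs x hx
  have hi : IntegrableOn (fun t => mixedHeatKernel n s x t) (Ioi 0) := by
    apply Integrable.mono' h1
    · exact ((H_meas n s).comp (measurable_const.prodMk measurable_id)).aestronglyMeasurable
    · filter_upwards [ae_restrict_mem measurableSet_Ioi] with t ht
      rw [Real.norm_eq_abs, abs_of_nonneg (H_nonneg hs x ht)]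
      exact H_le (by omega) hs x ht hx
  refine ⟨hi, ?_⟩
  rw [← h2]
  exact setIntegral_mono_on hi h1 measurableSet_Ioi fun t ht => H_le (by omega) hs x ht hx

lemma Z_nonneg {s : ℝ} (hs : s ∈ Ioo (0:ℝ) 1) (x : EuclideanSpace ℝ (Fin n)) :
    0 ≤ mixedZ n s x :=
  setIntegral_nonneg measurableSet_Ioi fun t ht => H_nonneg hs x ht

lemma H_pos_large (hn : 0 < n) {s : ℝ} (hs : s ∈ Ioo (0:ℝ) 1) (x : EuclideanSpace ℝ (Fin n)) :
    ∃ T : ℝ, 0 < T ∧ ∀ t, T < t → 0 < mixedHeatKernel n s x t := by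
  have hn' : Nonempty (Fin n) := ⟨⟨0, hn⟩⟩
  set ρ : ℝ := 1 / (2 * Real.pi * (‖x‖ + 1)) with hρ
  have hx0 := norm_nonneg x
  have hpi := Real.pi_pos
  have hρ0 : 0 < ρ := by positivity
  have hρ1 : 2 * Real.pi * (‖x‖ + 1) * ρ = 1 := by rw [hρ]; field_simp
  set q : ℝ := (ρ ^ 2) ^ s + ρ ^ 2 with hq
  set q' : ℝ := ((ρ / 2) ^ 2) ^ s + (ρ / 2) ^ 2 with hq'
  have hqq : q' < q := by
    have h1 : (ρ / 2) ^ 2 < ρ ^ 2 := by nlinarith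
    have h2 : ((ρ / 2) ^ 2) ^ s < (ρ ^ 2) ^ s := Real.rpow_lt_rpow (by positivity) h1 hs.1
    linarith
  set V : ℝ := volume.real (ball (0 : EuclideanSpace ℝ (Fin n)) (ρ / 2)) with hV
  have hV0 : 0 < V := by
    rw [hV, Measure.real]
    exact ENNReal.toReal_pos (measure_ball_pos _ _ (by positivity)).ne' measure_ball_lt_top.ne
  have hK := (gauss_int (0 : EuclideanSpace ℝ (Fin n)) one_pos).1
  simp only [inner_zero_left, mul_zero, Real.cos_zero, mul_one, one_mul] at hK
  set K : ℝ := ∫ ξ : EuclideanSpace ℝ (Fin n), Real.exp (-(‖ξ‖ ^ 2)) with hKdef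
  have hK0 : 0 ≤ K := integral_nonneg fun ξ => (Real.exp_pos _).le
  refine ⟨1 + 2 * K * Real.exp q / (V * (q - q')), ?_, ?_⟩
  · have : 0 < q - q' := by linarith
    positivity
  intro t ht
  have hd : 0 < q - q' := by linarith
  have hr0 : 0 ≤ 2 * K * Real.exp q / (V * (q - q')) := by positivity
  have ht1 : 1 ≤ t := by linarith
  have ht0 : 0 < t := by linarith
  have hpt : ∀ ξ : EuclideanSpace ℝ (Fin n),
      (ball (0 : EuclideanSpace ℝ (Fin n)) (ρ / 2)).indicator
        (fun _ => 1 / 2 * Real.exp (-(t * q'))) ξ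
        - Real.exp (-((t - 1) * q)) * Real.exp (-(‖ξ‖ ^ 2)) ≤
      Real.exp (-(t * (‖ξ‖ ^ 2) ^ s)) *
        (Real.exp (-(t * ‖ξ‖ ^ 2)) * Real.cos (2 * Real.pi * ⟪x, ξ⟫)) := by
    intro ξ
    have hz0 := norm_nonneg ξ
    rw [← mul_assoc, ← Real.exp_add, ← Real.exp_add]
    have hcos : ‖ξ‖ ≤ ρ → 1 / 2 ≤ Real.cos (2 * Real.pi * ⟪x, ξ⟫) := by
      intro h
      refine le_trans ?_ (Real.one_sub_sq_div_two_le_cos)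
      have h1 : |2 * Real.pi * ⟪x, ξ⟫| ≤ 1 := by
        rw [abs_mul, abs_of_pos (by positivity : (0:ℝ) < 2 * Real.pi)]
        calc 2 * Real.pi * |⟪x, ξ⟫| ≤ 2 * Real.pi * (‖x‖ * ‖ξ‖) := by
              gcongr; exact abs_real_inner_le_norm x ξ
          _ ≤ 2 * Real.pi * ((‖x‖ + 1) * ρ) := by gcongr; linarith
          _ = 1 := by linear_combination hρ1
      have h2 : (2 * Real.pi * ⟪x, ξ⟫) ^ 2 ≤ 1 := (sq_le_one_iff_abs_le_one _).2 h1
      linarith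
    by_cases h1 : ‖ξ‖ < ρ / 2
    · rw [indicator_of_mem (by simpa using h1)]
      have h2 := hcos (by linarith)
      have h3 : Real.exp (-(t * q')) ≤ Real.exp (-(t * (‖ξ‖ ^ 2) ^ s) + -(t * ‖ξ‖ ^ 2)) := by
        apply Real.exp_le_exp.2
        have h4 : (‖ξ‖ ^ 2) ^ s + ‖ξ‖ ^ 2 ≤ q' := by
          have hs0 := hs.1.le
          rw [hq']; gcongr
        nlinarith
      have h5 := Real.exp_pos (-((t - 1) * q) + -(‖ξ‖ ^ 2))
      have h6 := Real.exp_pos (-(t * q'))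
      nlinarith
    · rw [indicator_of_notMem (by simpa using h1)]
      by_cases h2 : ‖ξ‖ ≤ ρ
      · have h3 := hcos h2
        have h5 := Real.exp_pos (-((t - 1) * q) + -(‖ξ‖ ^ 2))
        have h6 := Real.exp_pos (-(t * (‖ξ‖ ^ 2) ^ s) + -(t * ‖ξ‖ ^ 2))
        nlinarith
      · push Not at h2
        have h3 : Real.exp (-(t * (‖ξ‖ ^ 2) ^ s) + -(t * ‖ξ‖ ^ 2)) ≤
            Real.exp (-((t - 1) * q) + -(‖ξ‖ ^ 2)) := by
          apply Real.exp_le_exp.2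
          have h4 : q ≤ (‖ξ‖ ^ 2) ^ s + ‖ξ‖ ^ 2 := by
            have hs0 := hs.1.le
            rw [hq]; gcongr
          have h5 : 0 ≤ (‖ξ‖ ^ 2) ^ s := by positivity
          nlinarith [mul_le_mul_of_nonneg_left h4 (by linarith : (0:ℝ) ≤ t - 1)]
        have h6 := Real.exp_pos (-(t * (‖ξ‖ ^ 2) ^ s) + -(t * ‖ξ‖ ^ 2))
        have h7 := Real.neg_one_le_cos (2 * Real.pi * ⟪x, ξ⟫)
        nlinarith
  have hindi : Integrable ((ball (0 : EuclideanSpace ℝ (Fin n)) (ρ / 2)).indicator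
        (fun _ => 1 / 2 * Real.exp (-(t * q')))) := by
    rw [integrable_indicator_iff measurableSet_ball]
    exact integrableOn_const measure_ball_lt_top.ne
  have hmono := integral_mono (hindi.sub (hK.const_mul (Real.exp (-((t - 1) * q)))))
    (by
      apply (gauss_int x ht0).1.bdd_mul (c := 1)
      · apply Measurable.aestronglyMeasurable
        fun_prop
      · filter_upwards with ξ
        rw [Real.norm_eq_abs, abs_of_pos (Real.exp_pos _), Real.exp_le_one_iff]
        have : 0 ≤ t * (‖ξ‖ ^ 2) ^ s := by positivity
        linarith) hpt
  rw [← H_eq s x ht0] at hmono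
  refine lt_of_lt_of_le ?_ hmono
  simp only [Pi.sub_apply]
  rw [integral_sub hindi (hK.const_mul _), integral_indicator measurableSet_ball,
    integral_const_mul (Real.exp (-((t - 1) * q))), setIntegral_const, smul_eq_mul, ← hV, ← hKdef,
    sub_pos]
  have h1 : 2 * K * Real.exp q < V * ((q - q') * t) := by
    have : 2 * K * Real.exp q / (V * (q - q')) < t := by linarith
    rw [div_lt_iff₀ (by positivity)] at this
    linarith
  have h2 : (q - q') * t < Real.exp ((q - q') * t) := by
    linarith [Real.add_one_le_exp ((q - q') * t)]
  have h3 : 2 * K * Real.exp q < V * Real.exp ((q - q') * t) :=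
    h1.trans (mul_lt_mul_of_pos_left h2 hV0)
  have h4 := mul_lt_mul_of_pos_right h3 (Real.exp_pos (-(t * q)))
  rw [mul_assoc, mul_assoc V, ← Real.exp_add, ← Real.exp_add] at h4
  rw [show -((t - 1) * q) = q + -(t * q) by ring]
  rw [show (q - q') * t + -(t * q) = -(t * q') by ring] at h4
  linarith

lemma Z_pos (hn : 4 < n) {s : ℝ} (hs : s ∈ Ioo (0:ℝ) 1) (x : EuclideanSpace ℝ (Fin n))
    (hx : x ≠ 0) : 0 < mixedZ n s x := by
  obtain ⟨T, hT, h⟩ := H_pos_large (by omega) hs x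
  unfold mixedZ
  rw [setIntegral_pos_iff_support_of_nonneg_ae _ (Z_bound hn hs x hx).1]
  · refine lt_of_lt_of_le ?_ (measure_mono (s := Ioi T) ?_)
    · simp
    · intro t ht
      exact ⟨(h t ht).ne', lt_trans hT ht⟩
  · filter_upwards [ae_restrict_mem measurableSet_Ioi] with t ht using H_nonneg hs x ht

lemma v_pos (hn : 4 < n) {s : ℝ} (hs : s ∈ Ioo (0:ℝ) 1) (x : EuclideanSpace ℝ (Fin n)) :
    0 < ∫ y in ball (0 : EuclideanSpace ℝ (Fin n)) (1 / 2), mixedZ n s (x - y) := by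
  have hn' : Nonempty (Fin n) := ⟨⟨0, by omega⟩⟩
  have hn1 : (4:ℝ) < n := by exact_mod_cast hn
  have hloc : LocallyIntegrable (mixedZ n s) := by
    refine locallyIntegrable_of_norm_le_rpow (C := CN n * Real.Gamma ((n:ℝ) / 2 - s))
      (α := (n:ℝ) - 2 * s) ?_ ?_ ?_ ?_
    · rw [finrank_euclideanSpace, Fintype.card_fin]; omega
    · rw [finrank_euclideanSpace, Fintype.card_fin]; linarith [hs.1]
    · have : ∀ᵐ x : EuclideanSpace ℝ (Fin n), x ≠ 0 := by
        have : Nontrivial (EuclideanSpace ℝ (Fin n)) := inferInstance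
        exact Measure.ae_ne volume 0
      filter_upwards [this] with x hx
      rw [Real.norm_eq_abs, abs_of_nonneg (Z_nonneg hs x)]
      exact (Z_bound hn hs x hx).2
    · exact (Z_meas n s).aestronglyMeasurable
  have hi : IntegrableOn (fun y => mixedZ n s (x - y))
      (ball (0 : EuclideanSpace ℝ (Fin n)) (1 / 2)) := by
    have h1 : IntegrableOn (mixedZ n s) (closedBall x (1 / 2)) :=
      hloc.integrableOn_isCompact (isCompact_closedBall _ _)
    have h2 := (Measure.measurePreserving_sub_left (volume : Measure (EuclideanSpace ℝ (Fin n))) x).integrableOn_comp_preimage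
      (MeasurableEquiv.subLeft x).measurableEmbedding (f := mixedZ n s) (s := closedBall x (1 / 2))
    have h3 := h2.2 h1
    refine h3.mono_set ?_
    intro y hy
    simp only [mem_preimage, mem_closedBall, dist_eq_norm]
    have : ‖y‖ < 1 / 2 := by simpa using hy
    rw [show x - y - x = -y by abel, norm_neg]
    exact this.le
  rw [setIntegral_pos_iff_support_of_nonneg_ae _ hi]
  · have h0 : volume (ball (0 : EuclideanSpace ℝ (Fin n)) (1 / 2) \ {x}) =
      volume (ball (0 : EuclideanSpace ℝ (Fin n)) (1 / 2)) := by
      apply measure_sdiff_null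
      exact measure_singleton x
    refine lt_of_lt_of_le ?_ (measure_mono
      (s := ball (0 : EuclideanSpace ℝ (Fin n)) (1 / 2) \ {x}) ?_)
    · rw [h0]; exact measure_ball_pos _ _ (by norm_num)
    · intro y hy
      refine ⟨(Z_pos hn hs _ ?_).ne', hy.1⟩
      intro h
      exact hy.2 (by simpa using (sub_eq_zero.1 h).symm)
  · filter_upwards with y using Z_nonneg hs _

lemma v_le (hn : 4 < n) {s : ℝ} (hs : s ∈ Ioo (0:ℝ) 1) :
    ∃ c₂ : ℝ, 0 < c₂ ∧ ∀ x : EuclideanSpace ℝ (Fin n), 1 < ‖x‖ →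
        (∫ y in ball (0 : EuclideanSpace ℝ (Fin n)) (1 / 2), mixedZ n s (x - y))
          ≤ c₂ / ‖x‖ ^ ((n : ℝ) - 2 * s) := by
  have hn1 : (4:ℝ) < n := by exact_mod_cast hn
  have hG : 0 < Real.Gamma ((n:ℝ) / 2 - s) := Real.Gamma_pos_of_pos (by linarith [hs.2])
  have hC := CN_pos (n := n) (by omega)
  set A := CN n * Real.Gamma ((n:ℝ) / 2 - s) with hA
  have hA0 : 0 < A := by positivity
  set V : ℝ := volume.real (ball (0 : EuclideanSpace ℝ (Fin n)) (1 / 2)) with hV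
  have hV0 : 0 ≤ V := measureReal_nonneg
  set m := (n:ℝ) - 2 * s with hm
  have hm0 : 0 < m := by linarith [hs.2]
  refine ⟨A * 2 ^ m * (V + 1), by positivity, ?_⟩
  intro x hx
  have hb := norm_setIntegral_le_of_norm_le_const (μ := volume)
    (s := ball (0 : EuclideanSpace ℝ (Fin n)) (1 / 2)) (f := fun y => mixedZ n s (x - y))
    (C := A * (‖x‖ / 2) ^ (-m)) measure_ball_lt_top (by
      intro y hy
      have hy1 : ‖y‖ < 1 / 2 := by simpa using hy
      have h1 : ‖x‖ / 2 ≤ ‖x - y‖ := by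
        have := norm_sub_norm_le x y
        linarith
      have h2 : x - y ≠ 0 := by
        rw [← norm_pos_iff]; linarith
      rw [Real.norm_eq_abs, abs_of_nonneg (Z_nonneg hs _)]
      refine (Z_bound hn hs _ h2).2.trans ?_
      apply mul_le_mul_of_nonneg_left _ hA0.le
      exact Real.rpow_le_rpow_of_nonpos (by linarith) h1 (by linarith))
  refine (le_abs_self _).trans (hb.trans ?_)
  have hx0 : 0 < ‖x‖ := by linarith
  rw [← hV, Real.rpow_neg (by positivity), Real.div_rpow hx0.le (by norm_num), inv_div]
  have hxm : 0 < ‖x‖ ^ m := by positivity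
  rw [mul_div_assoc', div_mul_eq_mul_div]
  gcongr
  linarith

lemma v_lim (hn : 4 < n) {s : ℝ} (hs : s ∈ Ioo (0:ℝ) 1) :
    Filter.Tendsto
      (fun x : EuclideanSpace ℝ (Fin n) =>
        ∫ y in ball (0 : EuclideanSpace ℝ (Fin n)) (1 / 2), mixedZ n s (x - y))
      (Filter.cocompact (EuclideanSpace ℝ (Fin n))) (nhds 0) := by
  have hn1 : (4:ℝ) < n := by exact_mod_cast hn
  obtain ⟨c, hc, h⟩ := v_le hn hs
  have hnorm := tendsto_norm_cocompact_atTop (E := EuclideanSpace ℝ (Fin n))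
  have hlim : Tendsto (fun x : EuclideanSpace ℝ (Fin n) => c / ‖x‖ ^ ((n : ℝ) - 2 * s))
      (Filter.cocompact (EuclideanSpace ℝ (Fin n))) (nhds 0) := by
    have : Tendsto (fun r : ℝ => c / r ^ ((n : ℝ) - 2 * s)) atTop (𝓝 0) :=
      (tendsto_rpow_atTop (by linarith [hs.2])).const_div_atTop c
    exact this.comp hnorm
  refine squeeze_zero' (Eventually.of_forall fun x => (v_pos hn hs x).le) ?_ hlim
  filter_upwards [hnorm.eventually_gt_atTop 1] with x hx using h x hx

end concrete
end MixedAux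

/-- The barrier `v = 𝓩 * χ_{B_{1/2}}` is positive, vanishes at infinity, and satisfies
`0 < v(x) ≤ c₂/|x|^{n-2s}` for `|x| > 1` (here `n > 4`). -/
theorem stmt17 (n : ℕ) (hn : 4 < n) (s : ℝ) (hs : s ∈ Ioo (0 : ℝ) 1) :
    (∀ x : EuclideanSpace ℝ (Fin n),
      0 < ∫ y in ball (0 : EuclideanSpace ℝ (Fin n)) (1 / 2), mixedZ n s (x - y)) ∧
    Filter.Tendsto
      (fun x : EuclideanSpace ℝ (Fin n) =>
        ∫ y in ball (0 : EuclideanSpace ℝ (Fin n)) (1 / 2), mixedZ n s (x - y))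
      (Filter.cocompact (EuclideanSpace ℝ (Fin n))) (nhds 0) ∧
    ∃ c₂ : ℝ, 0 < c₂ ∧
      ∀ x : EuclideanSpace ℝ (Fin n), 1 < ‖x‖ →
        (∫ y in ball (0 : EuclideanSpace ℝ (Fin n)) (1 / 2), mixedZ n s (x - y))
          ≤ c₂ / ‖x‖ ^ ((n : ℝ) - 2 * s) := by
  exact ⟨fun x => MixedAux.v_pos hn hs x, MixedAux.v_lim hn hs, MixedAux.v_le hn hs⟩
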